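/- Let [R] be a 1-current of finite mass in ℂ^m whose support is contained in a compact set K ⊂ ℂ^m of 2-dimensional Hausdorff measure zero, and suppose ([R], φ) = 0 for every (1,0)-form φ holomorphic in a neighborhood of K. Then [R] = 0. -/

import Mathlib

/-!
Statement 8 of arXiv:math/9905060 (Lemma 3.6): a 1-current of finite mass in
`ℂ^m`, supported in a compact set of 2-dimensional Hausdorff measure zero and
annihilating all `(1,0)`-forms holomorphic in a neighborhood of its support,
vanishes.  A 1-current of finite mass is represented concretely by a finite
measure `μ` (its total variation) together with a bounded measurable tangent
vector field `v` (a real tangent vector to `ℂ^m` being identified with an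
element of `ℂ^m`); its pairing with a `(1,0)`-form `Σ_j f_j dz_j` is
`∫ Σ_j f_j(x) v_j(x) dμ(x)`, and the current is zero iff `v = 0` μ-a.e.
-/

open MeasureTheory

open Set Metric Filter Topology Real ComplexConjugate

/-- The Cauchy kernel is locally integrable in the plane. -/
theorem locallyIntegrable_inv_complex : LocallyIntegrable (fun w : ℂ => w⁻¹) := by
  refine locallyIntegrable_of_norm_le_rpow (C := 1) (α := 1) ?_ ?_ ?_ ?_
  · simp [Complex.finrank_real_complex]
  · simp [Complex.finrank_real_complex]
  · refine Eventually.of_forall fun w => ?_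
    simp [Real.rpow_neg_one]
  · exact measurable_inv.aestronglyMeasurable

theorem integrableOn_ball_inv_sub (z : ℂ) (R : ℝ) :
    IntegrableOn (fun w : ℂ => (z - w)⁻¹) (ball 0 R) := by
  have h : IntegrableOn (fun w : ℂ => w⁻¹) ((fun w => z - w) '' closedBall 0 R) :=
    locallyIntegrable_inv_complex.integrableOn_isCompact
      ((isCompact_closedBall _ _).image (by fun_prop))
  have := ((Measure.measurePreserving_sub_left volume z).integrableOn_image
    (MeasurableEquiv.subLeft z).measurableEmbedding).1 h
  exact this.mono_set ball_subset_closedBall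

theorem circleAverage_inv_sub_of_lt {z : ℂ} {r : ℝ} (hr : 0 < r) (hrz : r < ‖z‖) :
    circleAverage (fun w => (z - w)⁻¹) 0 r = z⁻¹ := by
  have h : DiffContOnCl ℂ (fun w => (z - w)⁻¹) (ball 0 |r|) := by
    refine DifferentiableOn.diffContOnCl fun w hw => ?_
    have hw' := closure_ball_subset_closedBall hw
    rw [mem_closedBall_zero_iff, abs_of_pos hr] at hw'
    have hne : z - w ≠ 0 := fun h => by
      rw [sub_eq_zero.1 h] at hrz
      exact absurd hw' (not_le.2 hrz)
    exact (((differentiableAt_const z).sub differentiableAt_id).inv hne).differentiableWithinAt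
  simpa using h.circleAverage

theorem circleAverage_inv_sub_of_gt {z : ℂ} {r : ℝ} (hrz : ‖z‖ < r) :
    circleAverage (fun w => (z - w)⁻¹) 0 r = 0 := by
  have hr : 0 < r := (norm_nonneg z).trans_lt hrz
  rw [circleAverage_eq_circleIntegral hr.ne']
  simp only [sub_zero, smul_eq_mul, mul_eq_zero]
  right
  have hz : z ∈ ball (0 : ℂ) r := by simpa using hrz
  rcases eq_or_ne z 0 with rfl | hz0
  · have := circleIntegral.integral_sub_zpow_of_ne (n := -2) (by decide) 0 0 r
    have h4 := circleIntegral.integral_const_mul (-1 : ℂ) (fun w : ℂ => (w - 0) ^ (-2 : ℤ)) 0 r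
    rw [this, mul_zero] at h4
    refine Eq.trans ?_ h4
    refine circleIntegral.integral_congr hr.le fun w hw => ?_
    simp only [zpow_neg, sub_zero, zero_sub, inv_neg, zpow_ofNat]
    ring
  · have h1 := circleIntegral.integral_sub_inv_of_mem_ball (mem_ball_self (x := (0 : ℂ)) hr)
    have h2 := circleIntegral.integral_sub_inv_of_mem_ball hz
    have i1 : CircleIntegrable (fun w : ℂ => (w - 0)⁻¹) 0 r := by
      rw [circleIntegrable_sub_inv_iff]
      right
      simp [hr.ne, abs_of_pos hr]
    have i2 : CircleIntegrable (fun w : ℂ => (w - z)⁻¹) 0 r := by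
      rw [circleIntegrable_sub_inv_iff]
      right
      simp [abs_of_pos hr, hrz.ne]
    have h3 := circleIntegral.integral_sub i1 i2
    rw [h1, h2, sub_self] at h3
    have h4 := circleIntegral.integral_const_mul z⁻¹ (fun w : ℂ => (w - 0)⁻¹ - (w - z)⁻¹) 0 r
    rw [h3, mul_zero] at h4
    refine Eq.trans ?_ h4
    refine circleIntegral.integral_congr hr.le fun w hw => ?_
    have hw0 : w ≠ 0 := by
      rintro rfl
      simp [hr.ne] at hw
    have hwz : w - z ≠ 0 := fun h => by
      rw [sub_eq_zero.1 h] at hw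
      simp [hrz.ne] at hw
    have hwz' : z - w ≠ 0 := fun h => hwz (by rw [← neg_sub, h, neg_zero])
    simp only [sub_zero]
    field_simp
    ring

theorem integral_polar_angle_eq_circleAverage (f : ℂ → ℂ) (r : ℝ) :
    ∫ θ in Ioo (-π) π, f (Complex.polarCoord.symm (r, θ)) = (2 * π) • circleAverage f 0 r := by
  have h := circleAverage_eq_integral_add (f := f) (c := 0) (R := r) (-π)
  rw [h, smul_smul, mul_inv_cancel₀ (by positivity), one_smul,
    intervalIntegral.integral_comp_add_right (fun θ ↦ f (circleMap 0 r θ)),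
    show 0 + -π = -π by ring, show 2 * π + -π = π by ring,
    intervalIntegral.integral_of_le (by linarith [pi_pos]), integral_Ioc_eq_integral_Ioo]
  refine integral_congr_ae (Eventually.of_forall fun θ => ?_)
  simp [circleMap, Complex.exp_mul_I]

/-- Integration in polar coordinates, as an iterated integral of circle averages. -/
theorem integral_eq_integral_circleAverage {f : ℂ → ℂ} (hf : Integrable f) (hm : Measurable f) :
    ∫ w, f w = ∫ r in Ioi (0 : ℝ), r • ((2 * π) • circleAverage f 0 r) := by
  have hmeas : Measurable fun p : ℝ × ℝ => Complex.polarCoord.symm p := by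
    simp only [Complex.polarCoord_symm_apply]
    fun_prop
  have hi : IntegrableOn (fun p : ℝ × ℝ => p.1 • f (Complex.polarCoord.symm p))
      (Ioi (0 : ℝ) ×ˢ Ioo (-π) π) := by
    refine ⟨(measurable_fst.smul (hm.comp hmeas)).aestronglyMeasurable, ?_⟩
    have h := Complex.lintegral_comp_polarCoord_symm (fun w => ‖f w‖ₑ)
    have h2 := hf.2
    rw [hasFiniteIntegral_iff_enorm, ← h] at h2
    rw [hasFiniteIntegral_iff_enorm]
    refine lt_of_eq_of_lt (setLIntegral_congr_fun (measurableSet_Ioi.prod measurableSet_Ioo) ?_) h2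
    intro p hp
    simp only [enorm_smul, smul_eq_mul]
    rw [Real.enorm_of_nonneg (le_of_lt hp.1)]
  rw [← Complex.integral_comp_polarCoord_symm]
  change ∫ p in Ioi (0 : ℝ) ×ˢ Ioo (-π) π, _ = _
  rw [Measure.volume_eq_prod] at hi ⊢
  rw [setIntegral_prod _ hi]
  refine integral_congr_ae (Eventually.of_forall fun r => ?_)
  simp only [integral_smul, integral_polar_angle_eq_circleAverage]

/-- The Cauchy transform of a disc centered at the origin is `π` times conjugation inside it. -/
theorem integral_ball_inv_sub {z : ℂ} {R : ℝ} (hz : ‖z‖ < R) :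
    ∫ w in ball (0 : ℂ) R, (z - w)⁻¹ = π * conj z := by
  have hR : 0 < R := (norm_nonneg z).trans_lt hz
  rw [← integral_indicator measurableSet_ball, integral_eq_integral_circleAverage
    ((integrable_indicator_iff measurableSet_ball).2 (integrableOn_ball_inv_sub z R))
    (Measurable.indicator (by fun_prop) measurableSet_ball)]
  have key : ∀ᵐ r : ℝ, r ∈ Ioi (0 : ℝ) →
      r • ((2 * π) • circleAverage ((ball (0 : ℂ) R).indicator fun w => (z - w)⁻¹) 0 r) =
        (Ioo 0 ‖z‖).indicator (fun r : ℝ => (r : ℂ) * (2 * π * z⁻¹)) r := by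
    filter_upwards [compl_mem_ae_iff.2 (measure_singleton ‖z‖)] with r hrz hr
    have hr' : 0 < r := hr
    by_cases hrR : r < R
    · have : circleAverage ((ball (0 : ℂ) R).indicator fun w => (z - w)⁻¹) 0 r =
          circleAverage (fun w => (z - w)⁻¹) 0 r := by
        refine circleAverage_congr_sphere fun w hw => indicator_of_mem ?_ _
        rw [mem_sphere_zero_iff_norm, abs_of_pos hr'] at hw
        rwa [mem_ball_zero_iff, hw]
      rw [this]
      rcases lt_or_gt_of_ne hrz with h | h
      · rw [indicator_of_mem (show r ∈ Ioo 0 ‖z‖ from ⟨hr', h⟩), circleAverage_inv_sub_of_lt hr' h]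
        simp
      · rw [indicator_of_notMem (fun h' => lt_asymm h h'.2), circleAverage_inv_sub_of_gt h]
        simp
    · have : circleAverage ((ball (0 : ℂ) R).indicator fun w => (z - w)⁻¹) 0 r =
          circleAverage (fun _ => 0) 0 r := by
        refine circleAverage_congr_sphere fun w hw => indicator_of_notMem ?_ _
        rw [mem_sphere_zero_iff_norm, abs_of_pos hr'] at hw
        rwa [mem_ball_zero_iff, hw]
      rw [this, indicator_of_notMem (fun h' => hrR (h'.2.trans hz)), circleAverage_const]
      simp
  rw [setIntegral_congr_ae measurableSet_Ioi key, setIntegral_indicator measurableSet_Ioo,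
    inter_eq_right.2 (fun r hr => hr.1), integral_mul_const, integral_complex_ofReal,
    ← integral_Ioc_eq_integral_Ioo, ← intervalIntegral.integral_of_le (norm_nonneg z), integral_id]
  rcases eq_or_ne z 0 with rfl | hz0
  · simp
  · have := Complex.mul_conj' z
    push_cast
    field_simp
    rw [this]
    ring

/-- The Cauchy transform of Lebesgue measure on a bounded set is holomorphic off that set. -/
theorem differentiableOn_integral_inv_sub {U : Set ℂ} (hU : IsOpen U) (R : ℝ) :
    DifferentiableOn ℂ (fun z => ∫ w in ball (0 : ℂ) R \ U, (z - w)⁻¹) U := by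
  intro z₀ hz₀
  obtain ⟨r, hr, hrU⟩ := Metric.isOpen_iff.1 hU z₀ hz₀
  have hms : MeasurableSet (ball (0 : ℂ) R \ U) := measurableSet_ball.diff hU.measurableSet
  have hfar : ∀ w ∈ ball (0 : ℂ) R \ U, ∀ z ∈ ball z₀ (r / 2), r / 2 ≤ ‖z - w‖ := by
    intro w hw z hz
    by_contra! h
    refine hw.2 (hrU ?_)
    rw [mem_ball, dist_eq_norm] at hz ⊢
    calc ‖w - z₀‖ = ‖(z - z₀) - (z - w)‖ := by congr 1; ring
      _ ≤ ‖z - z₀‖ + ‖z - w‖ := norm_sub_le _ _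
      _ < r := by linarith
  have := hasDerivAt_integral_of_dominated_loc_of_deriv_le (𝕜 := ℂ)
    (μ := volume.restrict (ball (0 : ℂ) R \ U)) (F := fun z w => (z - w)⁻¹)
    (F' := fun z w => -1 / (z - w) ^ 2) (x₀ := z₀) (bound := fun _ => 1 / (r / 2) ^ 2)
    (ball_mem_nhds z₀ (half_pos hr))
    (Eventually.of_forall fun z =>
      ((measurable_const.sub measurable_id).inv).aestronglyMeasurable)
    ((integrableOn_ball_inv_sub z₀ R).mono_set sdiff_subset)
    (measurable_const.div ((measurable_const.sub measurable_id).pow_const 2)).aestronglyMeasurable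
    ?_ ?_ ?_
  · exact this.2.differentiableAt.differentiableWithinAt
  · filter_upwards [ae_restrict_mem hms] with w hw z hz
    rw [norm_div, norm_neg, norm_one, norm_pow]
    have := hfar w hw z hz
    gcongr
  · refine integrableOn_const (ne_of_lt ?_)
    exact (measure_mono sdiff_subset).trans_lt measure_ball_lt_top
  · filter_upwards [ae_restrict_mem hms] with w hw z hz
    have hne : z - w ≠ 0 := by
      have := hfar w hw z hz
      rw [← norm_pos_iff]
      linarith
    exact ((hasDerivAt_id z).sub_const w).inv hne

/-- On a compact plane set of zero area, conjugation is a uniform limit of functions holomorphic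
near the set. -/
theorem exists_differentiableOn_near_conj {L : Set ℂ} (hL : IsCompact L) (hL0 : volume L = 0)
    {ε : ℝ} (hε : 0 < ε) :
    ∃ (U : Set ℂ) (F : ℂ → ℂ), IsOpen U ∧ L ⊆ U ∧ DifferentiableOn ℂ F U ∧
      ∀ z ∈ L, ‖F z - conj z‖ ≤ ε := by
  obtain ⟨R, hR, hLR⟩ := hL.isBounded.exists_pos_norm_lt
  have hfin : ∫⁻ w in closedBall (0 : ℂ) (2 * R), ‖w⁻¹‖ₑ ≠ ⊤ :=
    (locallyIntegrable_inv_complex.integrableOn_isCompact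
      (isCompact_closedBall (0 : ℂ) (2 * R))).2.ne
  obtain ⟨δ, hδ, hsmall⟩ := exists_pos_setLIntegral_lt_of_measure_lt hfin
    (ENNReal.ofReal_pos.2 hε).ne'
  obtain ⟨U, hLU, hU, hUδ⟩ := L.exists_isOpen_lt_of_lt δ (by rwa [hL0])
  refine ⟨U, fun z => (π : ℂ)⁻¹ * ∫ w in ball (0 : ℂ) R \ U, (z - w)⁻¹, hU, hLU,
    (differentiableOn_integral_inv_sub hU R).const_mul _, fun z hz => ?_⟩
  have hsplit := integral_inter_add_sdiff (s := ball (0 : ℂ) R) hU.measurableSet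
    (integrableOn_ball_inv_sub z R)
  rw [integral_ball_inv_sub (hLR z hz)] at hsplit
  have hπ : (π : ℂ) ≠ 0 := by exact_mod_cast pi_ne_zero
  have hdiff : (π : ℂ)⁻¹ * (∫ w in ball (0 : ℂ) R \ U, (z - w)⁻¹) - conj z =
      -((π : ℂ)⁻¹ * ∫ w in ball (0 : ℂ) R ∩ U, (z - w)⁻¹) := by
    rw [eq_sub_of_add_eq' hsplit]
    field_simp
    ring
  have hbound : ‖∫ w in ball (0 : ℂ) R ∩ U, (z - w)⁻¹‖ ≤ ε := by
    have hle : ‖∫ w in ball (0 : ℂ) R ∩ U, (z - w)⁻¹‖ₑ ≤ ENNReal.ofReal ε := by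
      have hmeas : MeasurableSet (ball (0 : ℂ) R ∩ U) := measurableSet_ball.inter hU.measurableSet
      have hmp := Measure.measurePreserving_sub_left (volume : Measure ℂ) z
      have hme : MeasurableEmbedding fun w : ℂ => z - w :=
        (MeasurableEquiv.subLeft z).measurableEmbedding
      refine (enorm_integral_le_lintegral_enorm _).trans ?_
      rw [hmp.setLIntegral_comp_emb hme (fun w => ‖w⁻¹‖ₑ)]
      have hsub : (fun w : ℂ => z - w) '' (ball (0 : ℂ) R ∩ U) ⊆ closedBall 0 (2 * R) := by
        rintro _ ⟨w, hw, rfl⟩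
        rw [mem_closedBall_zero_iff]
        have h1 := hLR z hz
        have h2 := mem_ball_zero_iff.1 hw.1
        linarith [norm_sub_le z w]
      rw [← inter_eq_left.2 hsub, ← Measure.restrict_restrict (hme.measurableSet_image.2 hmeas)]
      refine (hsmall _ ((Measure.restrict_apply_le _ _).trans_lt ?_)).le
      rw [← hmp.measure_preimage_emb hme, preimage_image_eq _ hme.injective]
      exact (measure_mono inter_subset_right).trans_lt hUδ
    rw [← ofReal_norm] at hle
    exact (ENNReal.ofReal_le_ofReal_iff hε.le).1 hle
  simp only [hdiff, norm_neg, norm_mul, norm_inv, Complex.norm_real, Real.norm_eq_abs,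
    abs_of_pos pi_pos]
  calc π⁻¹ * ‖∫ w in ball (0 : ℂ) R ∩ U, (z - w)⁻¹‖ ≤ 1 * ε := by
        gcongr
        exact inv_le_one_of_one_le₀ (by linarith [pi_gt_three])
    _ = ε := one_mul ε

/-- Planar Lebesgue measure vanishes on Lipschitz images of `H₂`-null sets. -/
theorem volume_image_eq_zero_of_hausdorffMeasure_two {X : Type*} [EMetricSpace X]
    [MeasurableSpace X] [BorelSpace X] {f : X → ℂ} (hf : LipschitzWith 1 f) {K : Set X}
    (hK : μH[(2 : ℝ)] K = 0) : volume (f '' K) = 0 := by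
  have hg : LipschitzWith 1 (Complex.measurableEquivRealProd ∘ f) := by
    simpa using! Complex.lipschitz_equivRealProd.comp hf
  have h := hg.hausdorffMeasure_image_le (d := 2) (by norm_num) K
  rw [hK, mul_zero, nonpos_iff_eq_zero, hausdorffMeasure_prod_real] at h
  rwa [← Complex.volume_preserving_equiv_real_prod.measure_preimage_equiv,
    image_comp Complex.measurableEquivRealProd f K,
    preimage_image_eq _ Complex.measurableEquivRealProd.injective] at h

/-- Restrictions to `K` of functions holomorphic in a neighborhood of `K`. -/
def holomorphicGerms {E : Type*} [NormedAddCommGroup E] [NormedSpace ℂ E] (K : Set E) :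
    Subalgebra ℂ C(K, ℂ) where
  carrier := {g | ∃ (V : Set E) (F : E → ℂ), IsOpen V ∧ K ⊆ V ∧ AnalyticOnNhd ℂ F V ∧
    ∀ x : K, g x = F x}
  mul_mem' := by
    rintro g h ⟨V, F, hV, hKV, hF, hg⟩ ⟨W, G, hW, hKW, hG, hh⟩
    exact ⟨V ∩ W, F * G, hV.inter hW, subset_inter hKV hKW,
      (hF.mono inter_subset_left).mul (hG.mono inter_subset_right), fun x => by simp [hg, hh]⟩
  add_mem' := by
    rintro g h ⟨V, F, hV, hKV, hF, hg⟩ ⟨W, G, hW, hKW, hG, hh⟩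
    exact ⟨V ∩ W, F + G, hV.inter hW, subset_inter hKV hKW,
      (hF.mono inter_subset_left).add (hG.mono inter_subset_right), fun x => by simp [hg, hh]⟩
  algebraMap_mem' c :=
    ⟨univ, fun _ => c, isOpen_univ, subset_univ _, analyticOnNhd_const, fun _ => rfl⟩

/-- Functions holomorphic near a compact `H₂`-null set are uniformly dense in the continuous
functions on it. -/
theorem topologicalClosure_holomorphicGerms {m : ℕ} {K : Set (Fin m → ℂ)} [CompactSpace K]
    (hK2 : μH[(2 : ℝ)] K = 0) : (holomorphicGerms K).topologicalClosure = ⊤ := by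
  let coord : Fin m → C(K, ℂ) := fun j => ⟨fun x => (x : Fin m → ℂ) j,
    (continuous_apply j).comp continuous_subtype_val⟩
  have hcoord : ∀ j, coord j ∈ holomorphicGerms K := fun j =>
    ⟨univ, fun x => x j, isOpen_univ, subset_univ _,
      (ContinuousLinearMap.proj (R := ℂ) (φ := fun _ : Fin m => ℂ) j).analyticOnNhd univ,
      fun _ => rfl⟩
  have hstar : ∀ j, star (coord j) ∈ (holomorphicGerms K).topologicalClosure := by
    intro j
    rw [← SetLike.mem_coe, Subalgebra.topologicalClosure_coe, Metric.mem_closure_iff]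
    intro ε hε
    have hL : IsCompact ((fun x : Fin m → ℂ => x j) '' K) :=
      (isCompact_iff_compactSpace.2 ‹_›).image (continuous_apply j)
    obtain ⟨U, F, hU, hLU, hF, hFε⟩ := exists_differentiableOn_near_conj hL
      (volume_image_eq_zero_of_hausdorffMeasure_two (LipschitzWith.eval j) hK2) (half_pos hε)
    have hKU : ∀ x : K, (x : Fin m → ℂ) j ∈ U := fun x => hLU ⟨x, x.2, rfl⟩
    refine ⟨⟨fun x => F ((x : Fin m → ℂ) j), ?_⟩, ⟨(fun x => x j) ⁻¹' U, fun x => F (x j),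
      hU.preimage (continuous_apply j), fun x hx => hKU ⟨x, hx⟩, ?_, fun _ => rfl⟩, ?_⟩
    · exact hF.continuousOn.comp_continuous (coord j).continuous hKU
    · exact (hF.analyticOnNhd hU).comp
        ((ContinuousLinearMap.proj (R := ℂ) (φ := fun _ : Fin m => ℂ) j).analyticOnNhd _)
        fun _ h => h
    · refine lt_of_le_of_lt ((ContinuousMap.dist_le (half_pos hε).le).2 fun x => ?_)
        (half_lt_self hε)
      rw [dist_comm, dist_eq_norm]
      exact hFε _ ⟨x, x.2, rfl⟩
  let S : StarSubalgebra ℂ C(K, ℂ) := StarAlgebra.adjoin ℂ (range coord)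
  have hS : S.toSubalgebra ≤ (holomorphicGerms K).topologicalClosure := by
    rw [StarAlgebra.adjoin_toSubalgebra]
    refine Algebra.adjoin_le ?_
    rintro g (⟨j, rfl⟩ | hg)
    · exact (holomorphicGerms K).le_topologicalClosure (hcoord j)
    · obtain ⟨j, hj⟩ := hg
      rw [← star_star g, ← hj]
      exact hstar j
  have hsep : S.SeparatesPoints := by
    intro x y hxy
    obtain ⟨j, hj⟩ := Function.ne_iff.1 (fun h => hxy (Subtype.ext h))
    exact ⟨coord j, ⟨coord j, StarAlgebra.subset_adjoin ℂ _ ⟨j, rfl⟩, rfl⟩, hj⟩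
  have htop := ContinuousMap.starSubalgebra_topologicalClosure_eq_top_of_separatesPoints S hsep
  rw [eq_top_iff]
  intro g _
  have hg : g ∈ closure (S : Set C(K, ℂ)) := by
    have : g ∈ S.topologicalClosure := htop ▸ StarSubalgebra.mem_top
    exact this
  exact closure_minimal hS (Subalgebra.isClosed_topologicalClosure _) hg

/-- Let `[R]` be a `1`-current of finite mass in `ℂ^m`,
supported in a compact set `K` with `H₂(K) = 0`, such that `([R], φ) = 0` for
every `(1,0)`-form `φ` holomorphic in a neighborhood of `K`.  Then `[R] = 0`. -/
theorem statement8 {m : ℕ} (K : Set (Fin m → ℂ)) (hKc : IsCompact K)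
    (hK2 : μH[(2 : ℝ)] K = 0)
    (μ : Measure (Fin m → ℂ)) [IsFiniteMeasure μ] (hμK : μ Kᶜ = 0)
    (v : (Fin m → ℂ) → (Fin m → ℂ)) (hv : Measurable v) (hvb : ∀ x, ‖v x‖ ≤ 1)
    (hmom : ∀ (V : Set (Fin m → ℂ)) (f : (Fin m → ℂ) → (Fin m → ℂ)),
        IsOpen V → K ⊆ V → (∀ j, AnalyticOnNhd ℂ (fun x => f x j) V) →
        ∫ x, (∑ j, f x j * v x j) ∂μ = 0) :
    ∀ᵐ x ∂μ, v x = 0 := by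
  have : CompactSpace K := isCompact_iff_compactSpace.1 hKc
  have hμ : ∀ᵐ x ∂μ, x ∈ K := hμK
  have hvj : ∀ j x, ‖v x j‖ ≤ 1 := fun j x => (norm_le_pi_norm _ j).trans (hvb x)
  have hvm : ∀ j, Measurable fun x => v x j := fun j => (measurable_pi_apply j).comp hv
  have hvi : ∀ j, Integrable (fun x => v x j) μ := fun j =>
    Integrable.of_bound (hvm j).aestronglyMeasurable 1 (Eventually.of_forall (hvj j))
  have hcoord : ∀ j, ∀ᵐ x ∂μ, v x j = 0 := by
    intro j
    refine ae_eq_zero_of_integral_contDiff_smul_eq_zero (hvi j).locallyIntegrable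
      fun g hg hgc => ?_
    have hgcont : Continuous g := hg.continuous
    have hgi : Integrable (fun x => g x • v x j) μ := by
      obtain ⟨C, hC⟩ := hgcont.bounded_above_of_compact_support hgc
      exact (hvi j).bdd_smul C hgcont.aestronglyMeasurable (Eventually.of_forall hC)
    have hsmall : ∀ ε > 0, ‖∫ x, g x • v x j ∂μ‖ ≤ ε * μ.real univ := by
      intro ε hε
      let G : C(K, ℂ) := ⟨fun x => (g x : ℂ), by fun_prop⟩
      have hG : G ∈ closure (holomorphicGerms K : Set C(K, ℂ)) := by
        rw [← Subalgebra.topologicalClosure_coe, topologicalClosure_holomorphicGerms hK2]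
        trivial
      obtain ⟨H, ⟨V, F, hV, hKV, hF, hHF⟩, hGH⟩ := Metric.mem_closure_iff.1 hG ε hε
      have hzero : ∫ x, F x * v x j ∂μ = 0 := by
        have h := hmom V (fun x => Pi.single j (F x)) hV hKV fun i => by
          rcases eq_or_ne i j with rfl | hij
          · simpa using hF
          · simpa [hij] using analyticOnNhd_const
        simpa [Pi.single_apply, ite_mul] using h
      have hclose : ∀ᵐ x ∂μ, ‖g x • v x j - F x * v x j‖ ≤ ε := by
        filter_upwards [hμ] with x hx
        have h1 := (ContinuousMap.dist_apply_le_dist (f := G) (g := H) ⟨x, hx⟩).trans hGH.le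
        rw [hHF, dist_eq_norm] at h1
        rw [Complex.real_smul, ← sub_mul, norm_mul]
        exact (mul_le_mul h1 (hvj j x) (norm_nonneg _) hε.le).trans_eq (mul_one ε)
      have hFi : Integrable (fun x => F x * v x j) μ := by
        refine (hvi j).bdd_mul (c := ‖H‖) ?_ ?_
        · rw [← Measure.restrict_eq_self_of_ae_mem hμ]
          exact (hF.continuousOn.mono hKV).aestronglyMeasurable hKc.measurableSet
        · filter_upwards [hμ] with x hx
          exact hHF ⟨x, hx⟩ ▸ H.norm_coe_le_norm ⟨x, hx⟩
      rw [← sub_zero (∫ x, g x • v x j ∂μ), ← hzero, ← integral_sub hgi hFi]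
      exact norm_integral_le_of_norm_le_const hclose
    have hlim : Tendsto (fun ε : ℝ => ε * μ.real univ) (𝓝[>] 0) (𝓝 0) := by
      have : Tendsto (fun ε : ℝ => ε * μ.real univ) (𝓝 0) (𝓝 (0 * μ.real univ)) :=
        (continuous_id.mul continuous_const).tendsto 0
      rw [zero_mul] at this
      exact this.mono_left nhdsWithin_le_nhds
    exact norm_le_zero_iff.1 (ge_of_tendsto hlim
      (eventually_nhdsWithin_of_forall fun ε hε => hsmall ε hε))
  filter_upwards [ae_all_iff.2 hcoord] with x hx
  exact funext hx
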